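/- For w ∈ S_∞, the Edelman–Greene statistic EG(w) equals the number of involutions in S_{ℓ(w)} if and only if w is totally commutative. -/

import Mathlib

open Equiv

/-- The simple transposition `sᵢ = (i, i+1)` in `S_∞` (realized as `Equiv.Perm ℕ`). -/
def EGs (i : ℕ) : Equiv.Perm ℕ := Equiv.swap i (i + 1)

/-- Coxeter length: the minimal length of a word in the simple transpositions for `w`. -/
noncomputable def coxLength (w : Equiv.Perm ℕ) : ℕ :=
  sInf {k | ∃ l : List ℕ, (l.map EGs).prod = w ∧ l.length = k}

/-- `l` is a reduced word for `w`. -/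
def IsReducedWord (w : Equiv.Perm ℕ) (l : List ℕ) : Prop :=
  (l.map EGs).prod = w ∧ l.length = coxLength w

/-- Top-to-bottom, right-to-left reading word of a filling of `μ`. -/
def readingWord (μ : YoungDiagram) (T : ℕ → ℕ → ℕ) : List ℕ :=
  (List.range (μ.colLen 0)).flatMap fun i =>
    ((List.range (μ.rowLen i)).reverse).map fun j => T i j

/-- Standard Young tableaux of shape `μ`, as entry functions: strictly increasing along
rows and columns, zero outside `μ`, and the labels on the cells are exactly `1,…,|μ|`. -/
def SYTset (μ : YoungDiagram) : Set (ℕ → ℕ → ℕ) :=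
  {T | (∀ i j1 j2, j1 < j2 → (i, j2) ∈ μ.cells → T i j1 < T i j2) ∧
       (∀ i1 i2 j, i1 < i2 → (i2, j) ∈ μ.cells → T i1 j < T i2 j) ∧
       (∀ i j, (i, j) ∉ μ.cells → T i j = 0) ∧
       μ.cells.image (fun c => T c.1 c.2) = Finset.Icc 1 μ.card}

/-- Edelman–Greene tableaux of type `(μ, w)`, as entry functions: strictly increasing
along rows and columns, zero outside `μ`, whose reading word is a reduced word of `w`. -/
def EGset (μ : YoungDiagram) (w : Equiv.Perm ℕ) : Set (ℕ → ℕ → ℕ) :=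
  {T | (∀ i j1 j2, j1 < j2 → (i, j2) ∈ μ.cells → T i j1 < T i j2) ∧
       (∀ i1 i2 j, i1 < i2 → (i2, j) ∈ μ.cells → T i1 j < T i2 j) ∧
       (∀ i j, (i, j) ∉ μ.cells → T i j = 0) ∧
       IsReducedWord w (readingWord μ T)}

/-- Standardization: the cell `(i,j)` receives the rank of its entry, where equal
entries are ordered left to right (by column). -/
def stdEntry (μ : YoungDiagram) (T : ℕ → ℕ → ℕ) (i j : ℕ) : ℕ :=
  if (i, j) ∈ μ.cells then
    (μ.cells.filter fun c =>
      T c.1 c.2 < T i j ∨ (T c.1 c.2 = T i j ∧ c.2 < j) ∨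
        (T c.1 c.2 = T i j ∧ c.2 = j ∧ c.1 ≤ i)).card
  else 0

/-- `k` is a descent of the standard tableau `U`: the cell labeled `k - 1` lies weakly
east of the cell labeled `k`. -/
def IsDescent (μ : YoungDiagram) (U : ℕ → ℕ → ℕ) (k : ℕ) : Prop :=
  ∃ c ∈ μ.cells, ∃ c' ∈ μ.cells, U c.1 c.2 = k ∧ U c'.1 c'.2 = k - 1 ∧ c.2 ≤ c'.2

open scoped Classical in
/-- The sweep map: a cell's entry is one plus the number of descents of `U` that are
at most its label in `U`. -/
noncomputable def sweepEntry (μ : YoungDiagram) (U : ℕ → ℕ → ℕ) (i j : ℕ) : ℕ :=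
  if (i, j) ∈ μ.cells then
    ((Finset.Icc 1 (U i j)).filter fun k => IsDescent μ U k).card + 1
  else 0

/-- `w` is totally commutative: it has a reduced word whose letters are pairwise
at distance at least `2`. -/
def TotallyCommutative (w : Equiv.Perm ℕ) : Prop :=
  ∃ l : List ℕ, IsReducedWord w l ∧ l.Pairwise fun a b => 2 ≤ Nat.dist a b


/-- product of a word -/
def wp (l : List ℕ) : Equiv.Perm ℕ := (l.map EGs).prod

/-- a word is reduced if it is of minimal length for its product -/
def Redu (l : List ℕ) : Prop := ∀ l', wp l' = wp l → l.length ≤ l'.length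

@[simp] lemma wp_nil : wp [] = 1 := rfl
@[simp] lemma wp_cons (x l) : wp (x :: l) = EGs x * wp l := by simp [wp]
@[simp] lemma wp_append (l l') : wp (l ++ l') = wp l * wp l' := by simp [wp]

lemma IsReducedWord.redu {w l} (h : IsReducedWord w l) : wp l = w ∧ Redu l := by
  refine ⟨h.1, fun l' hl' => ?_⟩
  rw [h.2]
  apply Nat.sInf_le
  exact ⟨l', by rw [← h.1]; exact hl', rfl⟩

lemma Redu.tail {x l} (h : Redu (x :: l)) : Redu l := by
  intro l' hl'
  have := h (x :: l') (by simp [hl'])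
  simpa using this

lemma EGs_sq (x : ℕ) : EGs x * EGs x = 1 := by simp [EGs]

lemma EGs_apply (x y : ℕ) : EGs x y = if y = x then x + 1 else if y = x + 1 then x else y := by
  simp [EGs, Equiv.swap_apply_def]

lemma EGs_comm {x y : ℕ} (h : x + 2 ≤ y) : EGs x * EGs y = EGs y * EGs x := by
  ext z
  simp only [Equiv.Perm.mul_apply, EGs_apply]
  split_ifs <;> omega

lemma EGs_braid (x : ℕ) : EGs x * EGs (x+1) * EGs x = EGs (x+1) * EGs x * EGs (x+1) := by
  ext z
  simp only [Equiv.Perm.mul_apply, EGs_apply]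
  split_ifs <;> omega

/-- `s_{h-1} ... s_0` -/
def cyc : ℕ → Equiv.Perm ℕ
  | 0 => 1
  | h + 1 => EGs h * cyc h

def cycw : ℕ → List ℕ
  | 0 => []
  | h + 1 => h :: cycw h

lemma wp_cycw (h) : wp (cycw h) = cyc h := by
  induction h with
  | zero => rfl
  | succ h ih => simp [cycw, cyc, ih]

lemma length_cycw (h) : (cycw h).length = h := by
  induction h with
  | zero => rfl
  | succ h ih => simp [cycw, ih]

lemma cyc_zero_apply (h) : cyc h 0 = h := by
  induction h with
  | zero => rfl
  | succ h ih => simp [cyc, ih, EGs_apply]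

lemma cyc_comm_gt {x h : ℕ} (hx : h < x) : EGs x * cyc h = cyc h * EGs x := by
  induction h with
  | zero => simp [cyc]
  | succ h ih =>
    rw [cyc, ← mul_assoc, ← EGs_comm (by omega), mul_assoc, ih (by omega), mul_assoc]

lemma cyc_comm_lt {x h : ℕ} (hx : x + 2 ≤ h) : EGs x * cyc h = cyc h * EGs (x+1) := by
  induction h with
  | zero => omega
  | succ h ih =>
    rcases Nat.lt_or_ge (x + 2) (h + 1) with h1 | h1
    · rw [cyc, ← mul_assoc, EGs_comm (by omega), mul_assoc, ih (by omega), mul_assoc]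
    · obtain rfl : h = x + 1 := by omega
      rw [cyc, cyc, ← mul_assoc, ← mul_assoc, EGs_braid, mul_assoc, cyc_comm_gt (by omega)]
      simp [mul_assoc]

/-- remove the lowest wire from the word -/
def fres : List ℕ → ℕ × List ℕ
  | [] => (0, [])
  | x :: l =>
    if x = (fres l).1 then ((fres l).1 + 1, (fres l).2)
    else if (fres l).1 < x then ((fres l).1, (x - 1) :: (fres l).2)
    else ((fres l).1, x :: (fres l).2)

lemma fres_main (l : List ℕ) (h : Redu l) :
    wp l = cyc (fres l).1 * wp ((fres l).2.map (· + 1)) ∧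
    l.length = (fres l).1 + (fres l).2.length ∧
    (∀ N, (∀ x ∈ l, x < N) → (fres l).1 ≤ N ∧ ∀ x ∈ (fres l).2, x + 1 < N) := by
  induction l with
  | nil => simp [fres, cyc]
  | cons x l ih =>
    obtain ⟨ih1, ih2, ih3⟩ := ih h.tail
    have key : x + 1 ≠ (fres l).1 := by
      intro hx
      have := h (cycw x ++ (fres l).2.map (· + 1)) (by
        rw [wp_append, wp_cycw, wp_cons, ih1, ← hx, cyc, ← mul_assoc, ← mul_assoc, EGs_sq, one_mul])
      simp [length_cycw] at this
      omega
    rw [fres]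
    split_ifs with h1 h2
    · refine ⟨by simp [ih1, cyc, ← h1, mul_assoc], by simp; omega, fun N hN => ?_⟩
      have := ih3 N (fun y hy => hN y (by simp [hy]))
      have := hN x (by simp)
      exact ⟨by simp; omega, by tauto⟩
    · refine ⟨?_, by simp; omega, fun N hN => ?_⟩
      · simp only [List.map_cons, wp_cons, ih1]
        rw [← mul_assoc, cyc_comm_gt h2, Nat.sub_add_cancel (by omega), mul_assoc]
      · have := ih3 N (fun y hy => hN y (by simp [hy]))
        have := hN x (by simp)
        refine ⟨by tauto, ?_⟩
        simp only [List.mem_cons, forall_eq_or_imp]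
        exact ⟨by omega, by tauto⟩
    · refine ⟨?_, by simp; omega, fun N hN => ?_⟩
      · simp only [List.map_cons, wp_cons, ih1]
        rw [← mul_assoc, cyc_comm_lt (by omega), mul_assoc]
      · have := ih3 N (fun y hy => hN y (by simp [hy]))
        have := hN x (by simp)
        refine ⟨by tauto, ?_⟩
        simp only [List.mem_cons, forall_eq_or_imp]
        exact ⟨by omega, by tauto⟩

lemma fres_ne {x l} (h : Redu (x :: l)) : x + 1 ≠ (fres l).1 := by
  intro hx
  obtain ⟨ih1, ih2, ih3⟩ := fres_main l h.tail
  have := h (cycw x ++ (fres l).2.map (· + 1)) (by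
    rw [wp_append, wp_cycw, wp_cons, ih1, ← hx, cyc, ← mul_assoc, ← mul_assoc, EGs_sq, one_mul])
  simp [length_cycw] at this
  omega

lemma wp_shift (e : List ℕ) : wp (e.map (· + 1)) 0 = 0 ∧
    ∀ n, wp (e.map (· + 1)) (n + 1) = wp e n + 1 := by
  induction e with
  | nil => simp
  | cons x e ih =>
    constructor
    · simp [ih.1, EGs_apply]
    · intro n
      simp only [List.map_cons, wp_cons, Equiv.Perm.mul_apply, ih.2, EGs_apply]
      split_ifs <;> omega

lemma wp_shift_inj {e e' : List ℕ} :
    wp (e.map (· + 1)) = wp (e'.map (· + 1)) ↔ wp e = wp e' := by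
  constructor
  · intro h
    ext n
    have := (wp_shift e).2 n
    rw [h, (wp_shift e').2 n] at this
    omega
  · intro h
    ext n
    cases n with
    | zero => rw [(wp_shift e).1, (wp_shift e').1]
    | succ n => rw [(wp_shift e).2, (wp_shift e').2, h]

lemma fres_redu {l} (h : Redu l) : Redu (fres l).2 := by
  intro e he
  obtain ⟨h1, h2, -⟩ := fres_main l h
  have := h (cycw (fres l).1 ++ e.map (· + 1)) (by
    rw [wp_append, wp_cycw, h1, wp_shift_inj.2 he])
  simp [length_cycw] at this
  omega

lemma fres_unique {l l'} (h : Redu l) (h' : Redu l') (hw : wp l = wp l') :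
    (fres l).1 = (fres l').1 ∧ wp (fres l).2 = wp (fres l').2 := by
  obtain ⟨h1, -, -⟩ := fres_main l h
  obtain ⟨h1', -, -⟩ := fres_main l' h'
  have e : (fres l).1 = (fres l').1 := by
    have a1 : wp l 0 = (fres l).1 := by
      rw [h1, Equiv.Perm.mul_apply, (wp_shift _).1, cyc_zero_apply]
    have a2 : wp l' 0 = (fres l').1 := by
      rw [h1', Equiv.Perm.mul_apply, (wp_shift _).1, cyc_zero_apply]
    rw [← a1, ← a2, hw]
  refine ⟨e, wp_shift_inj.1 ?_⟩
  rw [h1, h1', e] at hw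
  exact mul_left_cancel hw

/-- same inversion pattern -/
def Pat (p q : ℕ × ℕ) : Prop := q.1 < p.1 ↔ q.2 < p.2

/-- diverged state -/
def DivS (l : List (ℕ × ℕ)) (α β : ℕ) (f g : ℕ × ℕ → ℕ) : Prop :=
  α < β ∧ (∀ i, α ≤ i → i < β → ∃ p ∈ l, g p = i ∧ i + 1 ≤ f p) ∧
  (α = 0 ∨ ∃ p ∈ l, f p + 1 = α ∧ α ≤ g p + 1)

lemma DivS.step {l : List (ℕ × ℕ)} {f g : ℕ × ℕ → ℕ} {p : ℕ × ℕ}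
    (hp : ∀ q ∈ l, (f q < f p ↔ g q < g p))
    (hd : DivS l (fres (l.map f)).1 (fres (l.map g)).1 f g)
    (hf : f p + 1 ≠ (fres (l.map f)).1) (hg : g p + 1 ≠ (fres (l.map g)).1) :
    DivS (p :: l) (fres ((p :: l).map f)).1 (fres ((p :: l).map g)).1 f g := by
  simp only [List.map_cons, fres]
  set α := (fres (l.map f)).1
  set β := (fres (l.map g)).1
  obtain ⟨d1, d2, d3⟩ := hd
  have eα : (if f p = α then (α + 1, (fres (l.map f)).2) else if α < f p then
    (α, (f p - 1) :: (fres (l.map f)).2) else (α, f p :: (fres (l.map f)).2)).1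
    = if f p = α then α + 1 else α := by split_ifs <;> rfl
  have eβ : (if g p = β then (β + 1, (fres (l.map g)).2) else if β < g p then
    (β, (g p - 1) :: (fres (l.map g)).2) else (β, g p :: (fres (l.map g)).2)).1
    = if g p = β then β + 1 else β := by split_ifs <;> rfl
  rw [eα, eβ]
  -- when f p = α, we get g p = α
  have hA : f p = α → g p = α := by
    intro h
    obtain ⟨r, hr, hr1, hr2⟩ := d2 α le_rfl d1
    have h1 := hp r hr
    have h2 : α ≤ g p := by
      rcases d3 with d3 | ⟨q, hq, hq1, hq2⟩
      · omega
      · have := hp q hq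
        omega
    omega
  have hB : g p = β → β + 1 ≤ f p := by
    intro h
    obtain ⟨r, hr, hr1, hr2⟩ := d2 (β - 1) (by omega) (by omega)
    have h1 := hp r hr
    omega
  refine ⟨by split_ifs <;> omega, ?_, ?_⟩
  · intro i hi1 hi2
    by_cases hi : i < β
    · obtain ⟨r, hr, hr'⟩ := d2 i (by split_ifs at hi1 <;> omega) hi
      exact ⟨r, by simp [hr], hr'⟩
    · refine ⟨p, by simp, ?_⟩
      split_ifs at hi2 <;> omega
  · split_ifs with h1
    · right
      exact ⟨p, by simp, by omega, by have := hA h1; omega⟩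
    · rcases d3 with d3 | ⟨q, hq, hq'⟩
      · exact Or.inl d3
      · exact Or.inr ⟨q, by simp [hq], hq'⟩

/-- the two words still agree on the lowest wire -/
def EqS (l : List (ℕ × ℕ)) : Prop :=
  ∃ (h : ℕ) (e : List (ℕ × ℕ)), fres (l.map Prod.fst) = (h, e.map Prod.fst) ∧
    fres (l.map Prod.snd) = (h, e.map Prod.snd) ∧ e.Pairwise Pat ∧
    (e.map Prod.fst = e.map Prod.snd → l.map Prod.fst = l.map Prod.snd) ∧
    (∀ i < h, (i, i) ∈ l) ∧
    (∀ p ∈ e, (p.1 = p.2 ∧ p.1 + 2 ≤ h) ∨ (p.1 + 1, p.2 + 1) ∈ l) ∧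
    (∀ p ∈ e, ∀ i, i + 2 ≤ h → (p.1 < i ↔ p.2 < i))

lemma EqS.step {l : List (ℕ × ℕ)} {x y : ℕ}
    (hp : ∀ q ∈ l, Pat (x, y) q) (hl : EqS l)
    (hf : x + 1 ≠ (fres (l.map Prod.fst)).1) (hg : y + 1 ≠ (fres (l.map Prod.snd)).1) :
    EqS ((x, y) :: l) ∨
    DivS ((x, y) :: l) (fres (((x, y) :: l).map Prod.fst)).1
      (fres (((x, y) :: l).map Prod.snd)).1 Prod.fst Prod.snd ∨
    DivS ((x, y) :: l) (fres (((x, y) :: l).map Prod.snd)).1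
      (fres (((x, y) :: l).map Prod.fst)).1 Prod.snd Prod.fst := by
  obtain ⟨h, e, h1, h2, h3, h4, h5, h6, h7⟩ := hl
  rw [h1] at hf
  rw [h2] at hg
  simp only at hf hg
  have hx0 : x < h → y = x := by
    intro hx
    have a := hp _ (h5 x hx)
    simp only [Pat] at a
    rcases Nat.eq_zero_or_pos x with h0 | h0
    · omega
    · have b := hp _ (h5 (x-1) (by omega))
      simp only [Pat] at b
      omega
  have hy0 : y < h → y = x := by
    intro hx
    have a := hp _ (h5 y hx)
    simp only [Pat] at a
    rcases Nat.eq_zero_or_pos y with h0 | h0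
    · omega
    · have b := hp _ (h5 (y-1) (by omega))
      simp only [Pat] at b
      omega
  by_cases hxh : x = h
  · by_cases hyh : y = h
    · subst hxh
      subst hyh
      left
      refine ⟨y + 1, e, ?_, ?_, h3, ?_, ?_, ?_, ?_⟩
      · simp [fres, h1]
      · simp [fres, h2]
      · intro he
        simp [h4 he]
      · intro i hi
        rcases Nat.lt_or_ge i y with hi | hi
        · simp [h5 i hi]
        · simp [show i = y by omega]
      · intro p hpe
        rcases h6 p hpe with a | a
        · left; omega
        · right; simp [a]
      · intro p hpe i hi
        rcases Nat.lt_or_ge (i + 1) y with hi' | hi'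
        · exact h7 p hpe i (by omega)
        · rcases h6 p hpe with a | a
          · omega
          · have := hp _ a
            simp only [Pat] at this
            omega
    · right; right
      simp only [List.map_cons, fres, h1, h2]
      have hyh' : h < y := by omega
      simp only [hxh, hyh, hyh', if_true, if_false]
      refine ⟨by omega, ?_, ?_⟩
      · intro i hi hi'
        exact ⟨(h, y), by simp, by simp; omega, by simp; omega⟩
      · rcases Nat.eq_zero_or_pos h with h0 | h0
        · exact Or.inl h0
        · right
          exact ⟨(h-1, h-1), by simp [h5 (h-1) (by omega)], by simp; omega, by simp; omega⟩
  · by_cases hyh : y = h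
    · right; left
      simp only [List.map_cons, fres, h1, h2]
      have hxh' : h < x := by omega
      simp only [hxh, hyh, hxh', if_true, if_false]
      refine ⟨by omega, ?_, ?_⟩
      · intro i hi hi'
        exact ⟨(x, h), by simp, by simp; omega, by simp; omega⟩
      · rcases Nat.eq_zero_or_pos h with h0 | h0
        · exact Or.inl h0
        · right
          exact ⟨(h-1, h-1), by simp [h5 (h-1) (by omega)], by simp; omega, by simp; omega⟩
    · left
      rcases Nat.lt_or_ge x h with hx | hx
      · have hyx := hx0 hx
        subst hyx
        have hn : ¬ h < y := by omega
        refine ⟨h, (y, y) :: e, ?_, ?_, ?_, ?_, ?_, ?_, ?_⟩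
        · simp [fres, h1, hxh, hn]
        · simp [fres, h2, hxh, hn]
        · refine List.Pairwise.cons ?_ h3
          intro p hpe
          exact h7 p hpe y (by omega)
        · intro he
          simp only [List.map_cons, List.cons.injEq, true_and] at he ⊢
          exact h4 he
        · intro i hi
          simp [h5 i hi]
        · intro p hpe
          rcases List.mem_cons.1 hpe with rfl | hpe
          · left; simp; omega
          · rcases h6 p hpe with a | a
            · left; exact a
            · right; simp [a]
        · intro p hpe
          rcases List.mem_cons.1 hpe with rfl | hpe
          · simp
          · exact h7 p hpe
      · have hx' : h < x := by omega
        have hy' : h < y := by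
          by_contra hc
          have := hy0 (by omega)
          omega
        refine ⟨h, (x-1, y-1) :: e, ?_, ?_, ?_, ?_, ?_, ?_, ?_⟩
        · simp [fres, h1, hxh, hx']
        · simp [fres, h2, hyh, hy']
        · refine List.Pairwise.cons ?_ h3
          intro p hpe
          rcases h6 p hpe with a | a
          · simp only [Pat]; omega
          · have := hp _ a
            simp only [Pat] at this ⊢
            omega
        · intro he
          simp only [List.map_cons, List.cons.injEq] at he ⊢
          exact ⟨by omega, h4 he.2⟩
        · intro i hi
          simp [h5 i hi]
        · intro p hpe
          rcases List.mem_cons.1 hpe with rfl | hpe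
          · right
            simp only [List.mem_cons, Prod.mk.injEq]
            left; omega
          · rcases h6 p hpe with a | a
            · left; exact a
            · right; simp [a]
        · intro p hpe
          rcases List.mem_cons.1 hpe with rfl | hpe
          · intro i hi
            simp only; omega
          · exact h7 p hpe

lemma tricho (l : List (ℕ × ℕ)) (ha : Redu (l.map Prod.fst)) (hb : Redu (l.map Prod.snd))
    (hp : l.Pairwise Pat) : EqS l ∨
    DivS l (fres (l.map Prod.fst)).1 (fres (l.map Prod.snd)).1 Prod.fst Prod.snd ∨
    DivS l (fres (l.map Prod.snd)).1 (fres (l.map Prod.fst)).1 Prod.snd Prod.fst := by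
  induction l with
  | nil =>
    left
    exact ⟨0, [], by simp [fres], by simp [fres], by simp, by simp, by simp, by simp, by simp⟩
  | cons p l ih =>
    obtain ⟨x, y⟩ := p
    rw [List.pairwise_cons] at hp
    simp only [List.map_cons] at ha hb
    have fa := fres_ne ha
    have fb := fres_ne hb
    rcases ih ha.tail hb.tail hp.2 with h | h | h
    · exact EqS.step hp.1 h fa fb
    · right; left
      exact DivS.step (p := (x, y)) hp.1 h fa fb
    · right; right
      exact DivS.step (p := (x, y)) (fun q hq => (hp.1 q hq).symm) h fb fa

theorem inj_words (N : ℕ) : ∀ (l : List (ℕ × ℕ)), (∀ p ∈ l, p.1 < N ∧ p.2 < N) →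
    Redu (l.map Prod.fst) → Redu (l.map Prod.snd) → wp (l.map Prod.fst) = wp (l.map Prod.snd) →
    l.Pairwise Pat → l.map Prod.fst = l.map Prod.snd := by
  induction N with
  | zero =>
    intro l hl _ _ _ _
    cases l with
    | nil => rfl
    | cons p l => exact absurd (hl p (by simp)).1 (by omega)
  | succ N ih =>
    intro l hl ha hb hw hp
    obtain ⟨u1, u2⟩ := fres_unique ha hb hw
    rcases tricho l ha hb hp with h | h | h
    · obtain ⟨h, e, h1, h2, h3, h4, -⟩ := h
      apply h4
      have ra := fres_redu ha
      have rb := fres_redu hb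
      have ba := ((fres_main _ ha).2.2 (N + 1) (by
        intro x hx
        obtain ⟨p, hp, rfl⟩ := List.mem_map.1 hx
        exact (hl p hp).1)).2
      have bb := ((fres_main _ hb).2.2 (N + 1) (by
        intro x hx
        obtain ⟨p, hp, rfl⟩ := List.mem_map.1 hx
        exact (hl p hp).2)).2
      rw [h1] at ra ba u2
      rw [h2] at rb bb u2
      refine ih e ?_ ra rb u2 h3
      intro p hpe
      have := ba p.1 (List.mem_map_of_mem hpe)
      have := bb p.2 (List.mem_map_of_mem hpe)
      omega
    · have := h.1; omega
    · have := h.1; omega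

/-- cells of a diagram in reading order -/
def rc (μ : YoungDiagram) : List (ℕ × ℕ) :=
  (List.range (μ.colLen 0)).flatMap fun i =>
    ((List.range (μ.rowLen i)).reverse).map fun j => (i, j)

lemma readingWord_eq (μ T) : readingWord μ T = (rc μ).map fun c => T c.1 c.2 := by
  simp [readingWord, rc, List.map_flatMap, Function.comp_def]

lemma mem_rc (μ : YoungDiagram) (c : ℕ × ℕ) : c ∈ rc μ ↔ c ∈ μ.cells := by
  obtain ⟨i, j⟩ := c
  simp only [rc, List.mem_flatMap, List.mem_range, List.mem_map, List.mem_reverse, Prod.mk.injEq,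
    YoungDiagram.mem_cells]
  constructor
  · rintro ⟨i', h1, j', h2, rfl, rfl⟩
    exact YoungDiagram.mem_iff_lt_rowLen.2 h2
  · intro h
    refine ⟨i, ?_, j, YoungDiagram.mem_iff_lt_rowLen.1 h, rfl, rfl⟩
    exact YoungDiagram.mem_iff_lt_colLen.1 (μ.up_left_mem le_rfl (Nat.zero_le _) h)

/-- strict reading order -/
def RO (c d : ℕ × ℕ) : Prop := c.1 < d.1 ∨ (c.1 = d.1 ∧ d.2 < c.2)

lemma rc_pairwise (μ : YoungDiagram) : (rc μ).Pairwise RO := by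
  rw [rc, List.pairwise_flatMap]
  constructor
  · intro i _
    rw [List.pairwise_map, List.pairwise_reverse]
    refine List.Pairwise.imp ?_ List.pairwise_lt_range
    intro a b hab
    exact Or.inr ⟨rfl, hab⟩
  · refine List.Pairwise.imp ?_ List.pairwise_lt_range
    intro a b hab x hx y hy
    obtain ⟨_, _, rfl⟩ := List.mem_map.1 hx
    obtain ⟨_, _, rfl⟩ := List.mem_map.1 hy
    exact Or.inl hab

lemma rc_nodup (μ : YoungDiagram) : (rc μ).Nodup := by
  refine List.Pairwise.imp ?_ (rc_pairwise μ)
  rintro a b hab rfl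
  rcases hab with h | h <;> omega

lemma rc_length (μ : YoungDiagram) : (rc μ).length = μ.card := by
  rw [← List.toFinset_card_of_nodup (rc_nodup μ)]
  congr 1
  ext c
  rw [List.mem_toFinset, mem_rc]

/-- cells below the cell in the standardization order -/
def stdF (μ : YoungDiagram) (T : ℕ → ℕ → ℕ) (d : ℕ × ℕ) : Finset (ℕ × ℕ) :=
  μ.cells.filter fun c => T c.1 c.2 < T d.1 d.2 ∨ (T c.1 c.2 = T d.1 d.2 ∧ c.1 ≤ d.1)

/-- standardization with ties broken by rows -/
def stdU (μ : YoungDiagram) (T : ℕ → ℕ → ℕ) (i j : ℕ) : ℕ :=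
  if (i, j) ∈ μ.cells then (stdF μ T (i, j)).card else 0

lemma stdU_lt {μ : YoungDiagram} {T : ℕ → ℕ → ℕ} {c d : ℕ × ℕ} (hc : c ∈ μ.cells) (hd : d ∈ μ.cells)
    (h : T c.1 c.2 < T d.1 d.2 ∨ (T c.1 c.2 = T d.1 d.2 ∧ c.1 < d.1)) :
    stdU μ T c.1 c.2 < stdU μ T d.1 d.2 := by
  rw [stdU, if_pos hc, stdU, if_pos hd]
  apply Finset.card_lt_card
  rw [Finset.ssubset_iff_of_subset]
  · refine ⟨d, ?_, ?_⟩
    · simp only [stdF, Finset.mem_filter]; exact ⟨hd, by simp⟩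
    · simp only [stdF, Finset.mem_filter]; omega
  · intro x hx
    simp only [stdF, Finset.mem_filter] at hx ⊢
    refine ⟨hx.1, ?_⟩
    omega

/-- row-strict fillings: trichotomy for the standardization order -/
lemma stdU_tri {μ : YoungDiagram} {T : ℕ → ℕ → ℕ}
    (hr : ∀ i j1 j2, j1 < j2 → (i, j2) ∈ μ.cells → T i j1 < T i j2)
    {c d : ℕ × ℕ} (hc : c ∈ μ.cells) (hd : d ∈ μ.cells) (hne : c ≠ d) :
    (T c.1 c.2 < T d.1 d.2 ∨ (T c.1 c.2 = T d.1 d.2 ∧ c.1 < d.1)) ∨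
    (T d.1 d.2 < T c.1 c.2 ∨ (T d.1 d.2 = T c.1 c.2 ∧ d.1 < c.1)) := by
  obtain ⟨i, j⟩ := c
  obtain ⟨i', j'⟩ := d
  simp only
  by_cases hi : i = i'
  · subst hi
    rcases Nat.lt_trichotomy j j' with h | h | h
    · have := hr i j j' h hd; omega
    · exact absurd (by rw [h]) hne
    · have := hr i j' j h hc; omega
  · omega

lemma stdU_mem {μ : YoungDiagram} {T : ℕ → ℕ → ℕ}
    (hr : ∀ i j1 j2, j1 < j2 → (i, j2) ∈ μ.cells → T i j1 < T i j2)
    (hcol : ∀ i1 i2 j, i1 < i2 → (i2, j) ∈ μ.cells → T i1 j < T i2 j) : stdU μ T ∈ SYTset μ := by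
  refine ⟨?_, ?_, ?_, ?_⟩
  · intro i j1 j2 hj h
    exact stdU_lt (c := (i, j1)) (d := (i, j2)) (μ.up_left_mem le_rfl hj.le h) h
      (Or.inl (hr i j1 j2 hj h))
  · intro i1 i2 j hi h
    exact stdU_lt (c := (i1, j)) (d := (i2, j)) (μ.up_left_mem hi.le le_rfl h) h
      (Or.inl (hcol i1 i2 j hi h))
  · intro i j h
    rw [stdU, if_neg h]
  · apply Finset.eq_of_subset_of_card_le
    · intro x hx
      obtain ⟨c, hc, rfl⟩ := Finset.mem_image.1 hx
      rw [stdU, if_pos hc, Finset.mem_Icc]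
      constructor
      · rw [Nat.succ_le_iff, Finset.card_pos]
        exact ⟨c, by simp only [stdF, Finset.mem_filter]; exact ⟨hc, by simp⟩⟩
      · exact Finset.card_le_card (Finset.filter_subset _ _)
    · rw [Finset.card_image_of_injOn]
      · simp [YoungDiagram.card]
      · intro c hc d hd h
        by_contra hne
        simp only at h
        rcases stdU_tri hr hc hd hne with h' | h'
        · have := stdU_lt hc hd h'; omega
        · have := stdU_lt hd hc h'; omega

lemma stdU_pat {μ : YoungDiagram} {T : ℕ → ℕ → ℕ}
    (hr : ∀ i j1 j2, j1 < j2 → (i, j2) ∈ μ.cells → T i j1 < T i j2)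
    {c d : ℕ × ℕ} (hc : c ∈ μ.cells) (hd : d ∈ μ.cells) (h : RO c d) :
    T d.1 d.2 < T c.1 c.2 ↔ stdU μ T d.1 d.2 < stdU μ T c.1 c.2 := by
  constructor
  · intro h'
    exact stdU_lt hd hc (Or.inl h')
  · intro h'
    by_contra hn
    have : T c.1 c.2 < T d.1 d.2 ∨ (T c.1 c.2 = T d.1 d.2 ∧ c.1 < d.1) := by
      rcases h with h | ⟨h1, h2⟩
      · omega
      · obtain ⟨i, j⟩ := c
        obtain ⟨i', j'⟩ := d
        simp only at h1 h2 hn ⊢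
        subst h1
        have := hr i j' j h2 hc
        omega
    have := stdU_lt hc hd this
    omega

lemma exists_bound (l : List (ℕ × ℕ)) : ∃ N, ∀ p ∈ l, p.1 < N ∧ p.2 < N := by
  induction l with
  | nil => exact ⟨0, by simp⟩
  | cons p l ih =>
    obtain ⟨N, hN⟩ := ih
    refine ⟨N + p.1 + p.2 + 1, ?_⟩
    intro q hq
    rcases List.mem_cons.1 hq with rfl | hq
    · omega
    · have := hN q hq; omega

theorem std_inj {μ : YoungDiagram} {w : Equiv.Perm ℕ} {T T' : ℕ → ℕ → ℕ} (hT : T ∈ EGset μ w)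
    (hT' : T' ∈ EGset μ w) (h : stdU μ T = stdU μ T') : T = T' := by
  obtain ⟨a1, a2, a3, a4⟩ := hT
  obtain ⟨b1, b2, b3, b4⟩ := hT'
  rw [readingWord_eq] at a4 b4
  have ra := a4.redu
  have rb := b4.redu
  set l := (rc μ).map fun c => (T c.1 c.2, T' c.1 c.2) with hl
  have e1 : l.map Prod.fst = (rc μ).map fun c => T c.1 c.2 := by simp [hl]
  have e2 : l.map Prod.snd = (rc μ).map fun c => T' c.1 c.2 := by simp [hl]
  have hp : l.Pairwise Pat := by
    rw [hl, List.pairwise_map]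
    refine List.Pairwise.imp_of_mem ?_ (rc_pairwise μ)
    intro c d hc hd hcd
    rw [mem_rc] at hc hd
    have x := stdU_pat a1 hc hd hcd
    have y := stdU_pat b1 hc hd hcd
    rw [← h] at y
    exact x.trans y.symm
  obtain ⟨N, hN⟩ := exists_bound l
  have key := inj_words N l hN (by rw [e1]; exact ra.2) (by rw [e2]; exact rb.2)
    (by rw [e1, e2, ra.1, rb.1]) hp
  rw [e1, e2, List.map_inj_left] at key
  ext i j
  by_cases hc : (i, j) ∈ μ.cells
  · exact key (i, j) ((mem_rc _ _).2 hc)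
  · rw [a3 i j hc, b3 i j hc]

/-- all standard tableaux of size `n` -/
def SA (n : ℕ) : Type :=
  {p : YoungDiagram × (ℕ → ℕ → ℕ) // p.1.card = n ∧ p.2 ∈ SYTset p.1}

/-- all EG tableaux -/
def EGA (w : Equiv.Perm ℕ) : Type :=
  {p : YoungDiagram × (ℕ → ℕ → ℕ) // p.1.card = coxLength w ∧ p.2 ∈ EGset p.1 w}

def stdMap (w : Equiv.Perm ℕ) (p : EGA w) : SA (coxLength w) :=
  ⟨(p.1.1, stdU p.1.1 p.1.2), p.2.1, stdU_mem p.2.2.1 p.2.2.2.1⟩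

lemma stdMap_inj (w : Equiv.Perm ℕ) : Function.Injective (stdMap w) := by
  rintro ⟨⟨μ, T⟩, h1, h2⟩ ⟨⟨μ', T'⟩, h1', h2'⟩ h
  have hm : μ = μ' := congrArg (fun z : SA (coxLength w) => z.1.1) h
  subst hm
  have h : stdU μ T = stdU μ T' := congrArg (fun z : SA (coxLength w) => z.1.2) h
  simp only at h1 h2 h1' h2'
  have := std_inj h2 h2' h
  subst this
  rfl

lemma dist_comm_EGs {x y : ℕ} (h : 2 ≤ Nat.dist x y) : Commute (EGs x) (EGs y) := by
  unfold Nat.dist at h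
  rcases Nat.le_total x y with h' | h'
  · exact EGs_comm (by omega)
  · exact (EGs_comm (by omega)).symm

/-- filling a standard tableau with the letters of a sorted list -/
def fillT (L : List ℕ) (μ : YoungDiagram) (U : ℕ → ℕ → ℕ) (i j : ℕ) : ℕ :=
  if (i, j) ∈ μ.cells then L.getD (U i j - 1) 0 else 0

lemma SYT_range {μ : YoungDiagram} {U : ℕ → ℕ → ℕ} (hU : U ∈ SYTset μ) {i j : ℕ}
    (h : (i, j) ∈ μ.cells) : 1 ≤ U i j ∧ U i j ≤ μ.card := by
  rw [← Finset.mem_Icc, ← hU.2.2.2]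
  exact Finset.mem_image.2 ⟨(i, j), h, rfl⟩

lemma SYT_injOn {μ : YoungDiagram} {U : ℕ → ℕ → ℕ} (hU : U ∈ SYTset μ) :
    Set.InjOn (fun c : ℕ × ℕ => U c.1 c.2) μ.cells := by
  apply Finset.injOn_of_card_image_eq
  rw [hU.2.2.2]
  simp [YoungDiagram.card]

lemma getD_strict {L : List ℕ} (hL : L.Pairwise (· < ·)) {i j : ℕ} (hij : i < j)
    (hj : j < L.length) : L.getD i 0 < L.getD j 0 := by
  rw [List.getD_eq_getElem _ _ hj, List.getD_eq_getElem _ _ (by omega)]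
  exact List.pairwise_iff_getElem.1 hL i j (by omega) hj hij

lemma getD_inj {L : List ℕ} (hL : L.Pairwise (· < ·)) {i j : ℕ} (hi : i < L.length)
    (hj : j < L.length) (h : L.getD i 0 = L.getD j 0) : i = j := by
  rcases Nat.lt_trichotomy i j with h' | h' | h'
  · have := getD_strict hL h' hj; omega
  · exact h'
  · have := getD_strict hL h' hi; omega

lemma fill_perm {L : List ℕ} {μ : YoungDiagram} {U : ℕ → ℕ → ℕ}
    (hU : U ∈ SYTset μ) (hc : μ.card = L.length) : (readingWord μ (fillT L μ U)).Perm L := by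
  have h1 : ((rc μ).map fun c => U c.1 c.2).Perm (List.range' 1 L.length) := by
    apply List.perm_of_nodup_nodup_toFinset_eq
    · apply List.Nodup.map_on _ (rc_nodup μ)
      intro c hc d hd h
      exact SYT_injOn hU ((mem_rc _ _).1 hc) ((mem_rc _ _).1 hd) h
    · exact List.nodup_range'
    · have : (rc μ).toFinset = μ.cells := by ext c; rw [List.mem_toFinset, mem_rc]
      ext x
      have := Finset.ext_iff.1 hU.2.2.2 x
      rw [Finset.mem_Icc, Finset.mem_image] at this
      simp only [List.mem_toFinset, List.mem_map, mem_rc, List.mem_range'_1]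
      rw [this, hc]
      omega
  have h2 := h1.map (fun k => L.getD (k - 1) 0)
  have h3 : (List.range' 1 L.length).map (fun k => L.getD (k - 1) 0) = L := by
    apply List.ext_getElem
    · simp
    · intro i h1 h2
      simp [List.getElem?_eq_getElem h2]
  rw [h3, List.map_map] at h2
  rw [readingWord_eq]
  convert h2 using 1
  apply List.map_congr_left
  intro c hc
  rw [mem_rc] at hc
  simp [fillT, hc]

lemma fill_mem {L l : List ℕ} {μ : YoungDiagram} {U : ℕ → ℕ → ℕ} {w : Equiv.Perm ℕ}
    (hL : L.Pairwise (· < ·)) (hp : L.Perm l) (hl : IsReducedWord w l)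
    (hd : l.Pairwise fun a b => 2 ≤ Nat.dist a b)
    (hU : U ∈ SYTset μ) (hc : μ.card = L.length) : fillT L μ U ∈ EGset μ w := by
  have key : ∀ i j i' j', (i, j) ∈ μ.cells → (i', j') ∈ μ.cells → U i j < U i' j' →
      fillT L μ U i j < fillT L μ U i' j' := by
    intro i j i' j' h h' hlt
    rw [fillT, fillT, if_pos h, if_pos h']
    have := SYT_range hU h
    have := SYT_range hU h'
    exact getD_strict hL (by omega) (by omega)
  refine ⟨?_, ?_, ?_, ?_⟩
  · intro i j1 j2 hj h
    exact key _ _ _ _ (μ.up_left_mem le_rfl hj.le h) h (hU.1 i j1 j2 hj h)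
  · intro i1 i2 j hi h
    exact key _ _ _ _ (μ.up_left_mem hi.le le_rfl h) h (hU.2.1 i1 i2 j hi h)
  · intro i j h
    rw [fillT, if_neg h]
  · have h1 := (fill_perm hU hc).trans hp
    refine ⟨?_, by rw [h1.length_eq, hl.2]⟩
    rw [← hl.1]
    refine (List.Perm.prod_eq' (h1.symm.map EGs) ?_).symm
    rw [List.pairwise_map]
    exact hd.imp dist_comm_EGs

lemma fill_inj {L : List ℕ} {μ : YoungDiagram} {U U' : ℕ → ℕ → ℕ}
    (hL : L.Pairwise (· < ·)) (hU : U ∈ SYTset μ) (hU' : U' ∈ SYTset μ) (hc : μ.card = L.length)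
    (h : fillT L μ U = fillT L μ U') : U = U' := by
  ext i j
  by_cases hm : (i, j) ∈ μ.cells
  · have := congrFun (congrFun h i) j
    rw [fillT, fillT, if_pos hm, if_pos hm] at this
    have a := SYT_range hU hm
    have b := SYT_range hU' hm
    have := getD_inj hL (by omega) (by omega) this
    omega
  · rw [hU.2.2.1 i j hm, hU'.2.2.1 i j hm]

theorem TC_inj {w : Equiv.Perm ℕ} (hw : TotallyCommutative w) :
    ∃ f : SA (coxLength w) → EGA w, Function.Injective f := by
  obtain ⟨l, hl, hd⟩ := hw
  have hp := List.perm_insertionSort (· ≤ ·) l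
  set L := l.insertionSort (· ≤ ·) with hLdef
  have hnd : L.Nodup := by
    rw [hp.nodup_iff]
    refine hd.imp ?_
    rintro a b hab rfl
    simp [Nat.dist_self] at hab
  have hL : L.Pairwise (· < ·) := by
    have hs : L.Pairwise (· ≤ ·) := List.pairwise_insertionSort (· ≤ ·) l
    exact (hs.and hnd).imp fun h => lt_of_le_of_ne h.1 h.2
  have hlen : L.length = coxLength w := by rw [hp.length_eq, hl.2]
  refine ⟨fun p => ⟨(p.1.1, fillT L p.1.1 p.1.2), p.2.1,
    fill_mem hL hp hl hd p.2.2 (p.2.1.trans hlen.symm)⟩, ?_⟩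
  rintro ⟨⟨μ, T⟩, h1, h2⟩ ⟨⟨μ', T'⟩, h1', h2'⟩ h
  have hm : μ = μ' := congrArg (fun z : EGA w => z.1.1) h
  subst hm
  have h : fillT L μ T = fillT L μ T' := congrArg (fun z : EGA w => z.1.2) h
  simp only at h1 h2 h1' h2'
  have := fill_inj hL h2 h2' (h1.trans hlen.symm) h
  subst this
  rfl

/-- one row -/
def rowY (n : ℕ) : YoungDiagram where
  cells := {0} ×ˢ Finset.range n
  isLowerSet := by
    rintro ⟨i, j⟩ ⟨i', j'⟩ h hm
    simp only [Finset.coe_product, Finset.coe_singleton, Set.mem_prod, Set.mem_singleton_iff,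
      Finset.mem_coe, Finset.mem_range, Prod.mk_le_mk] at h hm ⊢
    omega

/-- one column -/
def colY (n : ℕ) : YoungDiagram where
  cells := Finset.range n ×ˢ {0}
  isLowerSet := by
    rintro ⟨i, j⟩ ⟨i', j'⟩ h hm
    simp only [Finset.coe_product, Finset.coe_singleton, Set.mem_prod, Set.mem_singleton_iff,
      Finset.mem_coe, Finset.mem_range, Prod.mk_le_mk] at h hm ⊢
    omega

lemma mem_rowY {n i j : ℕ} : (i, j) ∈ (rowY n).cells ↔ i = 0 ∧ j < n := by simp [rowY]; omega
lemma mem_colY {n i j : ℕ} : (i, j) ∈ (colY n).cells ↔ i < n ∧ j = 0 := by simp [colY]; omega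
lemma card_rowY (n : ℕ) : (rowY n).card = n := by simp [rowY, YoungDiagram.card]
lemma card_colY (n : ℕ) : (colY n).card = n := by simp [colY, YoungDiagram.card]

lemma rowY_syt (n : ℕ) : (fun i j => if i = 0 ∧ j < n then j + 1 else 0) ∈ SYTset (rowY n) := by
  refine ⟨?_, ?_, ?_, ?_⟩
  · intro i j1 j2 hj h
    rw [mem_rowY] at h
    simp only
    split_ifs <;> omega
  · intro i j1 j2 hj h
    rw [mem_rowY] at h
    omega
  · intro i j h
    rw [mem_rowY] at h
    simp [h]
  · rw [card_rowY]
    ext x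
    simp only [Finset.mem_image, Prod.exists, mem_rowY, Finset.mem_Icc]
    constructor
    · rintro ⟨i, j, h, rfl⟩
      rw [if_pos h]; omega
    · intro h
      refine ⟨0, x - 1, by omega, ?_⟩
      rw [if_pos (by omega)]; omega

lemma colY_syt (n : ℕ) : (fun i j => if i < n ∧ j = 0 then i + 1 else 0) ∈ SYTset (colY n) := by
  refine ⟨?_, ?_, ?_, ?_⟩
  · intro i j1 j2 hj h
    rw [mem_colY] at h
    omega
  · intro i j1 j2 hj h
    rw [mem_colY] at h
    simp only
    split_ifs <;> omega
  · intro i j h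
    rw [mem_colY] at h
    simp [h]
  · rw [card_colY]
    ext x
    simp only [Finset.mem_image, Prod.exists, mem_colY, Finset.mem_Icc]
    constructor
    · rintro ⟨i, j, h, rfl⟩
      rw [if_pos h]; omega
    · intro h
      refine ⟨x - 1, 0, by omega, ?_⟩
      rw [if_pos (by omega)]; omega

lemma row_word {n : ℕ} {w} {T : ℕ → ℕ → ℕ} (h : T ∈ EGset (rowY n) w) :
    (readingWord (rowY n) T).Pairwise (· > ·) := by
  rw [readingWord_eq, List.pairwise_map]
  refine List.Pairwise.imp_of_mem ?_ (rc_pairwise _)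
  rintro ⟨i, j⟩ ⟨i', j'⟩ hc hd hcd
  rw [mem_rc] at hc hd
  have h1 := mem_rowY.1 hc
  have h2 := mem_rowY.1 hd
  simp only [RO] at hcd
  obtain ⟨rfl, -⟩ := h1
  obtain ⟨rfl, -⟩ := h2
  exact h.1 _ _ _ (by omega) hc

lemma col_word {n : ℕ} {w} {T : ℕ → ℕ → ℕ} (h : T ∈ EGset (colY n) w) :
    (readingWord (colY n) T).Pairwise (· < ·) := by
  rw [readingWord_eq, List.pairwise_map]
  refine List.Pairwise.imp_of_mem ?_ (rc_pairwise _)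
  rintro ⟨i, j⟩ ⟨i', j'⟩ hc hd hcd
  rw [mem_rc] at hc hd
  have h1 := mem_colY.1 hc
  have h2 := mem_colY.1 hd
  simp only [RO] at hcd
  obtain ⟨-, rfl⟩ := h1
  obtain ⟨-, rfl⟩ := h2
  exact h.2.1 _ _ _ (by omega) hd

lemma wp_fix_low {b : List ℕ} {z : ℕ} (h : ∀ x ∈ b, z < x) : wp b z = z := by
  induction b with
  | nil => rfl
  | cons x b ih =>
    have hx := h x (by simp)
    rw [wp_cons, Equiv.Perm.mul_apply, ih fun y hy => h y (by simp [hy]), EGs_apply]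
    split_ifs <;> omega

lemma incr_le {b : List ℕ} (hb : b.Pairwise (· < ·)) (z : ℕ) : wp b z ≤ z + 1 := by
  induction b with
  | nil => simp
  | cons x b ih =>
    rw [List.pairwise_cons] at hb
    rw [wp_cons, Equiv.Perm.mul_apply]
    rcases Nat.lt_or_ge z (x + 1) with hz | hz
    · rw [wp_fix_low (fun y hy => by have := hb.1 y hy; omega), EGs_apply]
      split_ifs <;> omega
    · have := ih hb.2
      rw [EGs_apply]
      split_ifs <;> omega

lemma wp_ge {P : List ℕ} {m z : ℕ} (hP : ∀ y ∈ P, m ≤ y) (hz : m ≤ z) : m ≤ wp P z := by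
  induction P with
  | nil => simpa
  | cons x P ih =>
    have := hP x (by simp)
    have := ih fun y hy => hP y (by simp [hy])
    rw [wp_cons, Equiv.Perm.mul_apply, EGs_apply]
    split_ifs <;> omega

lemma wp_fix_high {Q : List ℕ} {m z : ℕ} (hQ : ∀ y ∈ Q, y < m) (hz : m < z) : wp Q z = z := by
  induction Q with
  | nil => rfl
  | cons x Q ih =>
    have := hQ x (by simp)
    rw [wp_cons, Equiv.Perm.mul_apply, ih fun y hy => hQ y (by simp [hy]), EGs_apply]
    split_ifs <;> omega

lemma decr_gap {P Q : List ℕ} {x : ℕ} (h : (P ++ (x + 1) :: x :: Q).Pairwise (· > ·)) :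
    ∃ z, z + 2 ≤ wp (P ++ (x + 1) :: x :: Q) z := by
  rw [List.pairwise_append] at h
  obtain ⟨-, h2, h3⟩ := h
  rw [List.pairwise_cons, List.pairwise_cons] at h2
  refine ⟨(wp Q)⁻¹ x, ?_⟩
  have hz : (wp Q)⁻¹ x ≤ x := by
    by_contra hc
    have := wp_fix_high (m := x) (Q := Q) (fun y hy => h2.2.1 y hy) (not_le.1 hc)
    rw [← Equiv.Perm.mul_apply, mul_inv_cancel, Equiv.Perm.one_apply] at this
    omega
  have : x + 2 ≤ wp (P ++ (x + 1) :: x :: Q) ((wp Q)⁻¹ x) := by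
    rw [wp_append, Equiv.Perm.mul_apply]
    apply wp_ge
    · intro y hy
      have := h3 y hy (x + 1) (by simp)
      omega
    · simp [EGs_apply]
  omega

lemma decr_sep {a : List ℕ} (ha : a.Pairwise (· > ·)) (h : ∀ z, wp a z ≤ z + 1) :
    a.Pairwise fun x y => y + 2 ≤ x := by
  have : Std.Irrefl fun x y : ℕ => y + 2 ≤ x := ⟨fun a h => by omega⟩
  have : IsTrans ℕ fun x y : ℕ => y + 2 ≤ x := ⟨fun a b c h h' => by omega⟩
  rw [← List.isChain_iff_pairwise, List.isChain_iff_forall_rel_of_append_cons_cons]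
  intro u v P Q e
  subst e
  have h1 : u > v := by
    rw [List.pairwise_append] at ha
    exact (List.pairwise_cons.1 ha.2.1).1 v (by simp)
  by_contra hc
  obtain rfl : u = v + 1 := by omega
  obtain ⟨z, hz⟩ := decr_gap ha
  have := h z
  omega

theorem TC_of_surj {w : Equiv.Perm ℕ} (h : Function.Surjective (stdMap w)) :
    TotallyCommutative w := by
  obtain ⟨⟨⟨μ, T⟩, h1, h2⟩, e1⟩ := h ⟨(rowY _, _), card_rowY _, rowY_syt _⟩
  obtain ⟨⟨⟨μ', T'⟩, h1', h2'⟩, e1'⟩ := h ⟨(colY _, _), card_colY _, colY_syt _⟩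
  have hm : μ = rowY (coxLength w) := congrArg (fun z : SA (coxLength w) => z.1.1) e1
  have hm' : μ' = colY (coxLength w) := congrArg (fun z : SA (coxLength w) => z.1.1) e1'
  subst hm
  subst hm'
  simp only at h2 h2'
  have r := row_word h2
  have c := col_word h2'
  refine ⟨_, h2.2.2.2, ?_⟩
  have p1 := h2.2.2.2.redu.1
  have p2 := h2'.2.2.2.redu.1
  refine (decr_sep r fun z => ?_).imp ?_
  · rw [p1, ← p2]
    exact incr_le c z
  · intro a b hab
    unfold Nat.dist
    omega

/-- number of involutions -/
def Jn (n : ℕ) : ℕ := ∑ σ : Equiv.Perm (Fin n), if σ * σ = 1 then 1 else 0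

/-- number of involutions fixing a point -/
def Fn (n : ℕ) (a : Fin n) : ℕ := ∑ σ : Equiv.Perm (Fin n), if σ * σ = 1 ∧ σ a = a then 1 else 0

lemma dec_zero {n : ℕ} (e : Equiv.Perm (Fin n)) :
    Equiv.Perm.decomposeFin.symm (0, e) * Equiv.Perm.decomposeFin.symm (0, e) = 1 ↔ e * e = 1 := by
  rw [Equiv.ext_iff, Equiv.ext_iff, Fin.forall_fin_succ]
  simp

lemma dec_succ {n : ℕ} (a : Fin n) (e : Equiv.Perm (Fin n)) :
    Equiv.Perm.decomposeFin.symm (a.succ, e) * Equiv.Perm.decomposeFin.symm (a.succ, e) = 1 ↔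
      e * e = 1 ∧ e a = a := by
  have key : ∀ x, Equiv.Perm.decomposeFin.symm (a.succ, e) (Fin.succ x) =
      if e x = a then 0 else (e x).succ := by
    intro x
    rw [Equiv.Perm.decomposeFin_symm_apply_succ, Equiv.swap_apply_def]
    simp [Fin.succ_ne_zero]
  rw [Equiv.ext_iff, Equiv.ext_iff, Fin.forall_fin_succ]
  simp only [Equiv.Perm.mul_apply, Equiv.Perm.decomposeFin_symm_apply_zero, Equiv.Perm.one_apply,
    key]
  constructor
  · rintro ⟨h1, h2⟩
    have ha : e a = a := by
      by_contra hn
      rw [if_neg hn] at h1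
      exact Fin.succ_ne_zero _ h1
    refine ⟨fun x => ?_, ha⟩
    by_cases hx : x = a
    · rw [hx, ha, ha]
    · have h3 : e x ≠ a := fun h => hx (e.injective (h.trans ha.symm))
      have h4 : e (e x) ≠ a := fun h => h3 (e.injective (h.trans ha.symm))
      have := h2 x
      rw [if_neg h3, key, if_neg h4] at this
      exact Fin.succ_injective _ this
  · rintro ⟨h1, ha⟩
    refine ⟨by rw [if_pos ha], fun x => ?_⟩
    by_cases hx : x = a
    · rw [hx, if_pos ha, Equiv.Perm.decomposeFin_symm_apply_zero]
    · have h3 : e x ≠ a := fun h => hx (e.injective (h.trans ha.symm))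
      have h4 : e (e x) ≠ a := fun h => h3 (e.injective (h.trans ha.symm))
      rw [if_neg h3, key, if_neg h4, h1]

lemma Jn_succ (n : ℕ) : Jn (n + 1) = Jn n + ∑ a, Fn n a := by
  rw [Jn, ← Equiv.sum_comp Equiv.Perm.decomposeFin.symm, Fintype.sum_prod_type, Fin.sum_univ_succ]
  simp only [dec_zero, dec_succ]
  rfl

lemma Fn_zero (n : ℕ) : Fn (n + 1) 0 = Jn n := by
  rw [Fn, ← Equiv.sum_comp Equiv.Perm.decomposeFin.symm, Fintype.sum_prod_type, Fin.sum_univ_succ]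
  simp only [dec_zero, Equiv.Perm.decomposeFin_symm_apply_zero, and_true, Fin.succ_ne_zero,
    and_false, if_false, Finset.sum_const_zero, add_zero]
  rfl

lemma Fn_eq (n : ℕ) (a : Fin (n + 1)) : Fn (n + 1) a = Jn n := by
  rw [← Fn_zero, Fn, Fn, ← Equiv.sum_comp (MulAut.conj (Equiv.swap 0 a)).toEquiv]
  apply Finset.sum_congr rfl
  intro σ _
  have h1 : (MulAut.conj (Equiv.swap 0 a)).toEquiv σ * (MulAut.conj (Equiv.swap 0 a)).toEquiv σ = 1
      ↔ σ * σ = 1 := by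
    change (MulAut.conj (Equiv.swap 0 a)) σ * (MulAut.conj (Equiv.swap 0 a)) σ = 1 ↔ _
    rw [← map_mul, map_eq_one_iff _ (MulEquiv.injective _)]
  have h2 : (MulAut.conj (Equiv.swap 0 a)).toEquiv σ a = a ↔ σ 0 = 0 := by
    change (MulAut.conj (Equiv.swap 0 a)) σ a = a ↔ _
    rw [MulAut.conj_apply, Equiv.swap_inv, Equiv.Perm.mul_apply, Equiv.Perm.mul_apply,
      Equiv.swap_apply_right, Equiv.swap_apply_eq_iff, Equiv.swap_apply_right]
  simp only [h1, h2]

lemma Jn_rec (n : ℕ) : Jn (n + 1) = Jn n + n * Jn (n - 1) := by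
  rw [Jn_succ]
  cases n with
  | zero => simp
  | succ n => simp [Fn_eq]

lemma Jn_zero : Jn 0 = 1 := by decide

lemma Jn_card (n : ℕ) : Nat.card {σ : Equiv.Perm (Fin n) // σ * σ = 1} = Jn n := by
  rw [Nat.card_eq_fintype_card, Fintype.card_subtype, Jn, Finset.card_filter]

/-- addable row -/
abbrev addR (μ : ℕ → ℕ) (i : ℕ) : Prop := i = 0 ∨ μ i < μ (i - 1)
/-- removable row -/
abbrev remR (μ : ℕ → ℕ) (j : ℕ) : Prop := μ (j + 1) < μ j
def up (μ : ℕ → ℕ) (i : ℕ) : ℕ → ℕ := fun k => if k = i then μ k + 1 else μ k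
def dn (μ : ℕ → ℕ) (i : ℕ) : ℕ → ℕ := fun k => if k = i then μ k - 1 else μ k

def Uop (B : ℕ) (φ : (ℕ → ℕ) → ℕ) (μ : ℕ → ℕ) : ℕ :=
  ∑ i ∈ Finset.range B, if addR μ i then φ (up μ i) else 0
def Dop (B : ℕ) (φ : (ℕ → ℕ) → ℕ) (μ : ℕ → ℕ) : ℕ :=
  ∑ i ∈ Finset.range B, if remR μ i then φ (dn μ i) else 0

lemma cnt_add {B : ℕ} {μ : ℕ → ℕ} (hB : 0 < B) (h0 : ∀ i, B ≤ i + 1 → μ i = 0) :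
    ∑ i ∈ Finset.range B, (if addR μ i then 1 else 0) =
      ∑ i ∈ Finset.range B, (if remR μ i then 1 else 0) + 1 := by
  obtain ⟨C, rfl⟩ : ∃ C, B = C + 1 := ⟨B - 1, by omega⟩
  rw [Finset.sum_range_succ', Finset.sum_range_succ _ C]
  have h1 : ¬ remR μ C := by simp [remR, h0 C le_rfl]
  have h2 : addR μ 0 := Or.inl rfl
  rw [if_neg h1, if_pos h2]
  simp [addR, remR]

lemma offdiag {μ : ℕ → ℕ} {i j : ℕ} (hij : i ≠ j) :
    (addR μ i ∧ remR (up μ i) j) ↔ (remR μ j ∧ addR (dn μ j) i) := by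
  simp only [addR, remR, up, dn]
  rcases Nat.eq_zero_or_pos i with rfl | hi
  · simp [hij, hij.symm]
  · by_cases h : j + 1 = i
    · subst h
      simp
      omega
    · have : i - 1 ≠ j := by omega
      simp [hij, hij.symm, h, this]
      tauto

lemma up_dn {μ : ℕ → ℕ} {i j : ℕ} (hij : i ≠ j) : dn (up μ i) j = up (dn μ j) i := by
  ext k
  simp only [up, dn]
  split_ifs <;> omega

lemma dn_up_self (μ : ℕ → ℕ) (i : ℕ) : dn (up μ i) i = μ := by
  ext k
  simp only [up, dn]
  split_ifs <;> omega

lemma up_dn_self {μ : ℕ → ℕ} {i : ℕ} (h : remR μ i) : up (dn μ i) i = μ := by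
  ext k
  simp only [up, dn, remR] at *
  split_ifs with hk
  · subst hk; omega
  · rfl

lemma comm_UD {B : ℕ} {μ : ℕ → ℕ} (hB : 0 < B) (h0 : ∀ i, B ≤ i + 1 → μ i = 0)
    (ha : Antitone μ) (φ : (ℕ → ℕ) → ℕ) :
    Uop B (Dop B φ) μ = Dop B (Uop B φ) μ + φ μ := by
  have e1 : Uop B (Dop B φ) μ = ∑ i ∈ Finset.range B, ∑ j ∈ Finset.range B,
      ((if i = j then (if addR μ i then φ μ else 0) else 0) +
       (if i ≠ j then (if remR μ j ∧ addR (dn μ j) i then φ (up (dn μ j) i) else 0) else 0)) := by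
    apply Finset.sum_congr rfl
    intro i _
    by_cases h : addR μ i
    · rw [if_pos h]
      apply Finset.sum_congr rfl
      intro j _
      by_cases hij : i = j
      · subst hij
        have : remR (up μ i) i := by
          have := ha (Nat.le_succ i)
          simp [remR, up]
          omega
        simp [h, this, dn_up_self]
      · have := offdiag (μ := μ) hij
        simp only [h, true_and] at this
        simp only [hij, if_false, ne_eq, not_false_eq_true, if_true, ← this, up_dn hij, zero_add]
    · rw [if_neg h]
      symm
      apply Finset.sum_eq_zero
      intro j _
      by_cases hij : i = j
      · subst hij
        simp [h]
      · have := offdiag (μ := μ) hij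
        simp only [hij, if_false, ne_eq, not_false_eq_true, if_true, ← this, zero_add]
        rw [if_neg (fun hh => h hh.1)]
  have e2 : Dop B (Uop B φ) μ = ∑ j ∈ Finset.range B, ∑ i ∈ Finset.range B,
      ((if i = j then (if remR μ j then φ μ else 0) else 0) +
       (if i ≠ j then (if remR μ j ∧ addR (dn μ j) i then φ (up (dn μ j) i) else 0) else 0)) := by
    apply Finset.sum_congr rfl
    intro j _
    by_cases h : remR μ j
    · rw [if_pos h]
      apply Finset.sum_congr rfl
      intro i _
      by_cases hij : i = j
      · subst hij
        have : addR (dn μ i) i := by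
          rcases Nat.eq_zero_or_pos i with h1 | h1
          · exact Or.inl h1
          · right
            have := ha (show i - 1 ≤ i by omega)
            simp only [remR] at h
            simp only [dn, if_true]
            rw [if_neg (by omega)]
            omega
        simp [h, this, up_dn_self h]
      · simp [hij, h]
    · rw [if_neg h]
      symm
      apply Finset.sum_eq_zero
      intro i _
      simp [h]
  rw [e1, e2]
  simp only [Finset.sum_add_distrib]
  rw [Finset.sum_comm (s := Finset.range B) (t := Finset.range B)
    (f := fun j i => if i ≠ j then
      (if remR μ j ∧ addR (dn μ j) i then φ (up (dn μ j) i) else 0) else 0)]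
  have e3 : ∑ i ∈ Finset.range B, ∑ j ∈ Finset.range B,
      (if i = j then (if addR μ i then φ μ else 0) else 0) =
      (∑ i ∈ Finset.range B, (if addR μ i then 1 else 0)) * φ μ := by
    rw [Finset.sum_mul]
    apply Finset.sum_congr rfl
    intro i hi
    rw [Finset.sum_ite_eq, if_pos hi]
    split_ifs <;> simp
  have e4 : ∑ j ∈ Finset.range B, ∑ i ∈ Finset.range B,
      (if i = j then (if remR μ j then φ μ else 0) else 0) =
      (∑ i ∈ Finset.range B, (if remR μ i then 1 else 0)) * φ μ := by
    rw [Finset.sum_mul]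
    apply Finset.sum_congr rfl
    intro i hi
    rw [Finset.sum_ite_eq', if_pos hi]
    split_ifs <;> simp
  rw [e3, e4, cnt_add hB h0]
  ring

/-- number of `n`-step up-paths -/
def Nn (B : ℕ) : ℕ → (ℕ → ℕ) → ℕ
  | 0 => fun _ => 1
  | n + 1 => Uop B (Nn B n)

lemma Nn_rec (B n : ℕ) : ∀ μ : ℕ → ℕ, Antitone μ → n < B → (∀ i, B ≤ i + n + 1 → μ i = 0) →
    Nn B (n + 1) μ = Nn B n μ + n * Nn B (n - 1) μ + Dop B (Nn B n) μ := by
  induction n with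
  | zero =>
    intro μ ha hB h0
    have := cnt_add (B := B) (μ := μ) hB (fun i hi => h0 i (by omega))
    simp only [Nn, Uop, Dop, zero_mul, add_zero]
    omega
  | succ n ih =>
    intro μ ha hB h0
    have e : Nn B (n + 1 + 1) μ = ∑ i ∈ Finset.range B,
        ((if addR μ i then Nn B n (up μ i) else 0) +
         n * (if addR μ i then Nn B (n - 1) (up μ i) else 0) +
         (if addR μ i then Dop B (Nn B n) (up μ i) else 0)) := by
      rw [Nn, Uop]
      apply Finset.sum_congr rfl
      intro i hi
      by_cases h : addR μ i
      · simp only [if_pos h]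
        apply ih
        · intro a b hab
          have := ha hab
          simp only [up]
          rcases Nat.lt_or_ge a i with hai | hai
          · have h1 : b = i → μ b < μ a := by
              rintro rfl
              rcases h with h | h
              · omega
              · have := ha (show a ≤ b - 1 by omega)
                omega
            split_ifs <;> omega
          · split_ifs <;> omega
        · omega
        · intro k hk
          simp only [up]
          have := h0 k (by omega)
          rw [if_neg, this]
          rintro rfl
          rcases h with h | h
          · omega
          · have := h0 (k - 1) (by omega)
            omega
      · simp only [if_neg h]
        simp
    rw [e, Finset.sum_add_distrib, Finset.sum_add_distrib, ← Finset.mul_sum]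
    have hc := comm_UD (B := B) (μ := μ) (by omega) (fun i hi => h0 i (by omega)) ha (Nn B n)
    change Uop B (Nn B n) μ + n * Uop B (Nn B (n - 1)) μ + Uop B (Dop B (Nn B n)) μ = _
    rw [hc]
    have hn : n * Uop B (Nn B (n - 1)) μ = n * Nn B n μ := by
      cases n with
      | zero => simp
      | succ n => rfl
    rw [hn, Nat.add_sub_cancel]
    change _ = Uop B (Nn B n) μ + (n + 1) * Nn B n μ + Dop B (Uop B (Nn B n)) μ
    ring

lemma Nn_eq_Jn (B n : ℕ) (h : n ≤ B) : Nn B n (fun _ => 0) = Jn n := by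
  induction n using Nat.strong_induction_on with
  | _ n ih =>
    cases n with
    | zero => rw [Jn_zero]; rfl
    | succ n =>
      rw [Nn_rec B n _ (fun _ _ _ => le_rfl) (by omega) (fun _ _ => rfl), Jn_rec,
        ih n (by omega) (by omega), ih (n - 1) (by omega) (by omega)]
      simp [Dop]

lemma Nn_iter (B n : ℕ) : Nn B n = (Uop B)^[n] (fun _ => 1) := by
  induction n with
  | zero => rfl
  | succ n ih => rw [Function.iterate_succ_apply', ← ih]; rfl

/-- add a cell in an addable row -/
def addCell (μ : YoungDiagram) (i : ℕ) (h : addR μ.rowLen i) : YoungDiagram where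
  cells := insert (i, μ.rowLen i) μ.cells
  isLowerSet := by
    rintro ⟨a, b⟩ ⟨a', b'⟩ hle hm
    simp only [Finset.coe_insert, Set.mem_insert_iff, Prod.mk.injEq, Finset.mem_coe,
      YoungDiagram.mem_cells, Prod.mk_le_mk] at hle hm ⊢
    rcases hm with ⟨rfl, rfl⟩ | hm
    · by_cases ha : a' = a
      · subst ha
        by_cases hb : b' = μ.rowLen a'
        · exact Or.inl ⟨rfl, hb⟩
        · right
          rw [YoungDiagram.mem_iff_lt_rowLen]
          omega
      · right
        rcases h with h | h
        · omega
        · have := μ.rowLen_anti a' (a - 1) (by omega)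
          rw [YoungDiagram.mem_iff_lt_rowLen]
          omega
    · right
      exact μ.up_left_mem hle.1 hle.2 hm

lemma rowLen_notMem (μ : YoungDiagram) (i : ℕ) : (i, μ.rowLen i) ∉ μ.cells := by
  rw [YoungDiagram.mem_cells, YoungDiagram.mem_iff_lt_rowLen]
  omega

lemma card_addCell (μ : YoungDiagram) (i : ℕ) (h : addR μ.rowLen i) :
    (addCell μ i h).card = μ.card + 1 := by
  simp only [YoungDiagram.card, addCell]
  rw [Finset.card_insert_of_notMem (rowLen_notMem μ i)]

lemma rowLen_addCell (μ : YoungDiagram) (i : ℕ) (h : addR μ.rowLen i) :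
    (addCell μ i h).rowLen = up μ.rowLen i := by
  ext k
  have key : ∀ j, j < (addCell μ i h).rowLen k ↔ j < up μ.rowLen i k := by
    intro j
    rw [← YoungDiagram.mem_iff_lt_rowLen, ← YoungDiagram.mem_cells]
    simp only [addCell, Finset.mem_insert, Prod.mk.injEq, YoungDiagram.mem_cells, up,
      YoungDiagram.mem_iff_lt_rowLen]
    split_ifs with hk
    · subst hk; omega
    · omega
  have h1 := key ((addCell μ i h).rowLen k)
  have h2 := key (up μ.rowLen i k)
  omega

/-- add the largest label -/
def addU (μ : YoungDiagram) (i : ℕ) (U : ℕ → ℕ → ℕ) (a b : ℕ) : ℕ :=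
  if (a, b) = (i, μ.rowLen i) then μ.card + 1 else U a b

lemma SYT_le {μ : YoungDiagram} {U : ℕ → ℕ → ℕ} (hU : U ∈ SYTset μ) (i j : ℕ) :
    U i j ≤ μ.card := by
  by_cases h : (i, j) ∈ μ.cells
  · exact (SYT_range hU h).2
  · rw [hU.2.2.1 i j h]; omega

lemma addU_mem {μ : YoungDiagram} {i : ℕ} (h : addR μ.rowLen i) {U : ℕ → ℕ → ℕ}
    (hU : U ∈ SYTset μ) : addU μ i U ∈ SYTset (addCell μ i h) := by
  have hnm := rowLen_notMem μ i
  have key : ∀ a b a' b', (a, b) ≠ (a', b') → a ≤ a' → b ≤ b' →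
      (a', b') ∈ (addCell μ i h).cells → ((a', b') ∈ μ.cells → U a b < U a' b') →
      addU μ i U a b < addU μ i U a' b' := by
    intro a b a' b' hne ha hb hm hlt
    simp only [addCell, Finset.mem_insert] at hm
    rcases hm with hm | hm
    · have := SYT_le hU a b
      rw [addU, addU, if_pos hm, if_neg (by rw [← hm]; exact hne)]
      omega
    · have hm2 : (a, b) ∈ μ.cells := μ.up_left_mem ha hb hm
      have g1 : (a', b') ≠ (i, μ.rowLen i) := fun e => hnm (e ▸ hm)
      have g2 : (a, b) ≠ (i, μ.rowLen i) := fun e => hnm (e ▸ hm2)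
      rw [addU, addU, if_neg g1, if_neg g2]
      exact hlt hm
  refine ⟨?_, ?_, ?_, ?_⟩
  · intro a b b' hb hm
    exact key a b a b' (by simp; omega) le_rfl hb.le hm (fun hm => hU.1 a b b' hb hm)
  · intro a a' b ha hm
    exact key a b a' b (by simp; omega) ha.le le_rfl hm (fun hm => hU.2.1 a a' b ha hm)
  · intro a b hm
    simp only [addCell, Finset.mem_insert, not_or] at hm
    rw [addU, if_neg hm.1]
    exact hU.2.2.1 a b hm.2
  · rw [card_addCell]
    simp only [addCell, Finset.image_insert]
    have e1 : μ.cells.image (fun c => addU μ i U c.1 c.2) = Finset.Icc 1 μ.card := by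
      rw [← hU.2.2.2]
      apply Finset.image_congr
      intro c hc
      simp only [addU]
      rw [if_neg]
      intro e
      exact hnm (e ▸ hc)
    rw [e1]
    ext x
    simp only [addU, if_true, Finset.mem_insert, Finset.mem_Icc]
    omega

lemma SYT_lt {μ : YoungDiagram} {U : ℕ → ℕ → ℕ} (hU : U ∈ SYTset μ) {a b a' b' : ℕ}
    (ha : a ≤ a') (hb : b ≤ b') (hne : (a, b) ≠ (a', b')) (h : (a', b') ∈ μ.cells) :
    U a b < U a' b' := by
  have h1 : U a b ≤ U a b' := by
    rcases Nat.eq_or_lt_of_le hb with rfl | hb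
    · exact le_rfl
    · exact (hU.1 a b b' hb (μ.up_left_mem ha le_rfl h)).le
  rcases Nat.eq_or_lt_of_le ha with rfl | ha
  · have : b ≠ b' := fun e => hne (by rw [e])
    exact hU.1 a b b' (by omega) h
  · have := hU.2.1 a a' b' ha h
    omega

/-- row bound -/
lemma row_lt_card {μ : YoungDiagram} {a b : ℕ} (h : (a, b) ∈ μ.cells) : a < μ.card := by
  have : (Finset.range (a + 1)).image (fun k => (k, b)) ⊆ μ.cells := by
    intro x hx
    obtain ⟨k, hk, rfl⟩ := Finset.mem_image.1 hx
    rw [Finset.mem_range] at hk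
    exact μ.up_left_mem (by omega) le_rfl h
  have := Finset.card_le_card this
  rw [Finset.card_image_of_injective _ (fun x y hxy => (Prod.mk.inj hxy).1),
    Finset.card_range] at this
  exact this

lemma SYT_split {ν : YoungDiagram} {V : ℕ → ℕ → ℕ} {n : ℕ} (hn : ν.card = n + 1)
    (hV : V ∈ SYTset ν) : ∃ (μ : YoungDiagram) (i : ℕ) (h : addR μ.rowLen i) (U : ℕ → ℕ → ℕ),
      μ.card = n ∧ i ≤ n ∧ U ∈ SYTset μ ∧ addCell μ i h = ν ∧ addU μ i U = V := by
  have hmem : n + 1 ∈ Finset.Icc 1 ν.card := by rw [hn, Finset.mem_Icc]; omega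
  rw [← hV.2.2.2] at hmem
  obtain ⟨⟨p, q⟩, hc, hVc⟩ := Finset.mem_image.1 hmem
  simp only at hVc
  have hmax : ∀ a b, p ≤ a → q ≤ b → (a, b) ∈ ν.cells → (a, b) = (p, q) := by
    intro a b ha hb hm
    by_contra hne
    have := SYT_lt hV ha hb (fun e => hne e.symm) hm
    have := SYT_le hV a b
    omega
  let μ : YoungDiagram := ⟨ν.cells.erase (p, q), by
    rintro ⟨a, b⟩ ⟨a', b'⟩ hle hm
    rw [Finset.mem_coe, Finset.mem_erase] at hm ⊢
    refine ⟨?_, ν.up_left_mem hle.1 hle.2 hm.2⟩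
    intro e
    rw [Prod.mk.injEq] at e
    obtain ⟨rfl, rfl⟩ := e
    exact hm.1 (hmax a b hle.1 hle.2 hm.2)⟩
  have hμ : ∀ a b, (a, b) ∈ μ.cells ↔ (a, b) ≠ (p, q) ∧ (a, b) ∈ ν.cells := by
    intro a b
    exact Finset.mem_erase
  have hcard : μ.card = n := by
    have := Finset.card_erase_of_mem hc
    change (ν.cells.erase (p, q)).card = n
    change ν.cells.card = n + 1 at hn
    omega
  have hrow : μ.rowLen p = q := by
    have key : ∀ j, j < μ.rowLen p ↔ j < q := by
      intro j
      rw [← YoungDiagram.mem_iff_lt_rowLen, ← YoungDiagram.mem_cells, hμ]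
      constructor
      · rintro ⟨h1, h2⟩
        by_contra hj
        exact h1 (hmax p j le_rfl (by omega) h2)
      · intro hj
        exact ⟨by simp; omega, ν.up_left_mem le_rfl hj.le hc⟩
    have h1 := key (μ.rowLen p)
    have h2 := key q
    omega
  have hadd : addR μ.rowLen p := by
    rcases Nat.eq_zero_or_pos p with h0 | h0
    · exact Or.inl h0
    · right
      rw [hrow, ← YoungDiagram.mem_iff_lt_rowLen, ← YoungDiagram.mem_cells, hμ]
      exact ⟨by simp; omega, ν.up_left_mem (by omega) le_rfl hc⟩
  have hlt := row_lt_card hc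
  let U : ℕ → ℕ → ℕ := fun a b => if (a, b) = (p, q) then 0 else V a b
  have hUV : ∀ a b, (a, b) ∈ μ.cells → U a b = V a b := by
    intro a b h
    exact if_neg ((hμ a b).1 h).1
  refine ⟨μ, p, hadd, U, hcard, by omega, ⟨?_, ?_, ?_, ?_⟩, ?_, ?_⟩
  · intro a b b' hb hm
    rw [hUV a b' hm, hUV a b (μ.up_left_mem le_rfl hb.le hm)]
    exact hV.1 a b b' hb ((hμ _ _).1 hm).2
  · intro a a' b hb hm
    rw [hUV a' b hm, hUV a b (μ.up_left_mem hb.le le_rfl hm)]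
    exact hV.2.1 a a' b hb ((hμ _ _).1 hm).2
  · intro a b hm
    rw [hμ, not_and'] at hm
    by_cases h : (a, b) ∈ ν.cells
    · exact if_pos (not_not.1 (hm h))
    · simp only [U]
      rw [hV.2.2.1 a b h, ite_self]
  · rw [hcard]
    ext x
    have hx := Finset.ext_iff.1 hV.2.2.2 x
    rw [Finset.mem_image, Finset.mem_Icc, hn] at hx
    rw [Finset.mem_image, Finset.mem_Icc]
    constructor
    · rintro ⟨⟨a, b⟩, hm, rfl⟩
      simp only
      rw [hUV a b hm]
      have hm' := (hμ a b).1 hm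
      have h1 := SYT_range hV hm'.2
      have h2 : V a b ≠ n + 1 := by
        intro e
        exact hm'.1 (SYT_injOn hV hm'.2 hc (by simp only; omega))
      omega
    · intro hx'
      obtain ⟨⟨a, b⟩, hm, e⟩ := hx.2 (by omega)
      simp only at e
      have hm' : (a, b) ∈ μ.cells := by
        rw [hμ]
        refine ⟨?_, hm⟩
        intro e'
        rw [Prod.mk.injEq] at e'
        obtain ⟨rfl, rfl⟩ := e'
        omega
      exact ⟨(a, b), hm', by rw [hUV a b hm', e]⟩
  · apply YoungDiagram.ext
    simp only [addCell, hrow]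
    exact Finset.insert_erase hc
  · ext a b
    rw [addU, hrow, hcard]
    by_cases h : (a, b) = (p, q)
    · rw [if_pos h]
      rw [Prod.mk.injEq] at h
      rw [h.1, h.2, hVc]
    · rw [if_neg h]
      exact if_neg h

lemma add_inj {μ μ' : YoungDiagram} {i i' : ℕ} (h : addR μ.rowLen i) (h' : addR μ'.rowLen i')
    {U U' : ℕ → ℕ → ℕ} (hU : U ∈ SYTset μ) (hU' : U' ∈ SYTset μ')
    (e1 : addCell μ i h = addCell μ' i' h') (e2 : addU μ i U = addU μ' i' U') :
    μ = μ' ∧ i = i' ∧ U = U' := by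
  have hc : μ.card = μ'.card := by
    have := congrArg YoungDiagram.card e1
    rw [card_addCell, card_addCell] at this
    omega
  have hcell : (i, μ.rowLen i) = (i', μ'.rowLen i') := by
    by_contra hne
    have := congrFun (congrFun e2 i) (μ.rowLen i)
    rw [addU, addU, if_pos rfl, if_neg hne] at this
    have := SYT_le hU' i (μ.rowLen i)
    omega
  have hμ : μ = μ' := by
    apply YoungDiagram.ext
    have := congrArg (fun ν : YoungDiagram => ν.cells.erase (i, μ.rowLen i)) e1
    simp only [addCell] at this
    rw [Finset.erase_insert (rowLen_notMem μ i), hcell,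
      Finset.erase_insert (rowLen_notMem μ' i')] at this
    exact this
  have hi : i = i' := (Prod.mk.inj hcell).1
  subst hμ
  subst hi
  refine ⟨rfl, rfl, ?_⟩
  ext a b
  by_cases hab : (a, b) = (i, μ.rowLen i)
  · have hm := rowLen_notMem μ i
    rw [← hab] at hm
    rw [hU.2.2.1 a b hm, hU'.2.2.1 a b hm]
  · have := congrFun (congrFun e2 a) b
    rwa [addU, addU, if_neg hab, if_neg hab] at this

/-- the growth map -/
def grow (B n : ℕ) (x : Σ p : SA n, {i // i ∈ (Finset.range B).filter fun i => addR p.1.1.rowLen i}) :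
    SA (n + 1) :=
  ⟨(addCell x.1.1.1 x.2.1 (Finset.mem_filter.1 x.2.2).2, addU x.1.1.1 x.2.1 x.1.1.2),
    by rw [card_addCell, x.1.2.1], addU_mem (Finset.mem_filter.1 x.2.2).2 x.1.2.2⟩

lemma grow_bij {B n : ℕ} (hB : n < B) : Function.Bijective (grow B n) := by
  constructor
  · rintro ⟨⟨⟨μ, U⟩, h1, h2⟩, ⟨i, hi⟩⟩ ⟨⟨⟨μ', U'⟩, h1', h2'⟩, ⟨i', hi'⟩⟩ h
    have e1 := congrArg (fun z : SA (n + 1) => z.1.1) h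
    have e2 := congrArg (fun z : SA (n + 1) => z.1.2) h
    simp only [grow] at e1 e2
    simp only at h1 h2 h1' h2'
    obtain ⟨q1, q2, q3⟩ := add_inj _ _ h2 h2' e1 e2
    subst q1
    subst q2
    subst q3
    rfl
  · rintro ⟨⟨ν, V⟩, h1, h2⟩
    obtain ⟨μ, i, h, U, a1, a2, a3, a4, a5⟩ := SYT_split h1 h2
    refine ⟨⟨⟨(μ, U), a1, a3⟩, ⟨i, Finset.mem_filter.2 ⟨Finset.mem_range.2 (by omega), h⟩⟩⟩, ?_⟩
    apply Subtype.ext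
    exact Prod.ext a4 a5

lemma SA_sum (B n : ℕ) (hB : n ≤ B) : ∃ _ : Fintype (SA n), ∀ φ : (ℕ → ℕ) → ℕ,
    ∑ p : SA n, φ p.1.1.rowLen = (Uop B)^[n] φ (fun _ => 0) := by
  induction n with
  | zero =>
    have hb0 : (⊥ : YoungDiagram).rowLen = fun _ => 0 := by
      ext i
      by_contra hne
      have : (i, 0) ∈ (⊥ : YoungDiagram) :=
        YoungDiagram.mem_iff_lt_rowLen.2 (Nat.pos_of_ne_zero hne)
      exact YoungDiagram.notMem_bot _ this
    have huniq : ∀ p : SA 0, p.1.1 = ⊥ ∧ p.1.2 = fun _ _ => 0 := by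
      rintro ⟨⟨μ, U⟩, h1, h2⟩
      have hc : μ.cells = ∅ := Finset.card_eq_zero.1 h1
      refine ⟨YoungDiagram.ext hc, ?_⟩
      ext a b
      exact h2.2.2.1 a b (by simp only; rw [hc]; simp)
    have hne : Nonempty (SA 0) := by
      refine ⟨⟨(⊥, fun _ _ => 0), by simp [YoungDiagram.card], ?_⟩⟩
      refine ⟨?_, ?_, ?_, ?_⟩ <;> simp [YoungDiagram.card]
    have hsub : Subsingleton (SA 0) := by
      constructor
      intro p q
      apply Subtype.ext
      exact Prod.ext ((huniq p).1.trans (huniq q).1.symm) ((huniq p).2.trans (huniq q).2.symm)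
    obtain ⟨p0⟩ := hne
    refine ⟨Fintype.ofSubsingleton p0, fun φ => ?_⟩
    let _ : Fintype (SA 0) := Fintype.ofSubsingleton p0
    rw [Fintype.sum_subsingleton _ p0, (huniq p0).1, hb0]
    rfl
  | succ n ih =>
    obtain ⟨inst, ih⟩ := ih (by omega)
    have hb := grow_bij (B := B) (n := n) (by omega)
    refine ⟨Fintype.ofBijective _ hb, fun φ => ?_⟩
    let _ := Fintype.ofBijective _ hb
    rw [← hb.sum_comp, Fintype.sum_sigma, Function.iterate_succ_apply, ← ih]
    apply Finset.sum_congr rfl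
    intro p _
    rw [Uop, ← Finset.sum_filter, ← Finset.sum_coe_sort (Finset.filter _ _)]
    apply Finset.sum_congr rfl
    intro i _
    simp only [grow, rowLen_addCell]

lemma SA_card (n : ℕ) : Finite (SA n) ∧ Nat.card (SA n) = Jn n := by
  obtain ⟨inst, h⟩ := SA_sum n n le_rfl
  refine ⟨inferInstance, ?_⟩
  have := h (fun _ => 1)
  rw [← Nn_iter, Nn_eq_Jn n n le_rfl] at this
  rw [Nat.card_eq_fintype_card, ← this]
  simp

/-- `EG(w)` equals the number of involutions in `S_{ℓ(w)}` iff `w` is totally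
commutative. -/
theorem stmt19 (w : Equiv.Perm ℕ) (hw : ∃ l : List ℕ, (l.map EGs).prod = w) :
    Nat.card {p : YoungDiagram × (ℕ → ℕ → ℕ) //
        p.1.card = coxLength w ∧ p.2 ∈ EGset p.1 w}
      = Nat.card {σ : Equiv.Perm (Fin (coxLength w)) // σ * σ = 1} ↔
    TotallyCommutative w := by
  obtain ⟨hfin, hcard⟩ := SA_card (coxLength w)
  have hinj := stdMap_inj w
  rw [Jn_card, ← hcard]
  change Nat.card (EGA w) = _ ↔ _
  constructor
  · intro h
    exact TC_of_surj (hinj.bijective_of_nat_card_le h.ge).2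
  · intro h
    obtain ⟨f, hf⟩ := TC_inj h
    have : Finite (EGA w) := Finite.of_injective _ hinj
    exact le_antisymm (Nat.card_le_card_of_injective _ hinj) (Nat.card_le_card_of_injective _ hf)
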